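/- Let M be a finite-horizon latent MDP with state space S and fix h ∈ {1,…,H−1} and α > 0. Let Ψ_h, Γ ⊂ Π be finite nonempty sets of policies, and suppose Ψ_h is an α-truncated policy cover at step h. Let ρ denote the mixture distribution over policies that with probability 1/2 picks π uniformly from Ψ_h and with probability 1/2 uniformly from Γ. Then: (1) for every s ∈ S_h(Γ): E_{π~ρ}[d^{M,π}_h(s)] ≥ min(ασ, σ′)/2; (2) for every f : S ∪ {⊥} → [0,∞) with f(⊥) = 0: E_{π~ρ}[ E^{M,π}[f(s_h)] ] ≥ (min(ασ,σ′)/2) · sup_{π∈Π} E^{M̄(Γ),π}[f(s_h)]; and (3) for every s′ ∈ S: Σ_{s∈S} E_{π~ρ}[d^{M,π}_h(s)] · (1/|A|) Σ_{a∈A} P_{h+1}(s′|s,a) ≥ (min(ασ,σ′)/(2|A|)) · sup_{π∈Π} d^{M̄(Γ),π}_{h+1}(s′). -/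

import Mathlib

open scoped Classical

section MDPDefs

/- Throughout, internal step index `k : ℕ` corresponds to step `k + 1` of the informal
statement (so an informal step `h ∈ {1,…,H}` is the internal index `h - 1`).
`P1` is the initial latent-state distribution and `P k s a s'` is the transition
probability from state `s` at internal step `k` to state `s'` at internal step `k+1`
(i.e. the transition kernel `P_{k+2}` of the informal statement). -/

variable {S A : Type*}

/-- `π` is a valid (time-inhomogeneous, possibly randomized) policy:
at every internal step `k` and state `s`, `π k s` is a distribution on actions. -/
def IsPolicy [Fintype A] (π : ℕ → S → A → ℝ) : Prop :=
  ∀ k s, (∀ a, 0 ≤ π k s a) ∧ ∑ a, π k s a = 1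

/-- Visitation probabilities in the (untruncated) latent MDP `M = (P1, P)`:
`visit P1 P π k s` is `d^{M,π}_{k+1}(s)` of the informal statement. -/
noncomputable def visit [Fintype S] [Fintype A] (P1 : S → ℝ)
    (P : ℕ → S → A → S → ℝ) (π : ℕ → S → A → ℝ) : ℕ → S → ℝ
  | 0, s => P1 s
  | k + 1, s' => ∑ s, ∑ a, visit P1 P π k s * π k s a * P k s a s'

/-- Visitation probabilities in the `T`-truncated MDP: the state space is `Option S`,
with `none` playing the role of the absorbing terminal state `⊥`, and `T k` is the
truncation set used for the transition into internal step `k` (i.e. the set `T_{k+1}`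
of the informal statement). -/
noncomputable def truncVisit [Fintype S] [Fintype A] (P1 : S → ℝ)
    (P : ℕ → S → A → S → ℝ) (T : ℕ → Set S) (π : ℕ → S → A → ℝ) :
    ℕ → Option S → ℝ
  | 0, some s => if s ∈ T 0 then P1 s else 0
  | 0, none => ∑ s ∈ Finset.univ.filter (fun s => s ∉ T 0), P1 s
  | k + 1, some s' =>
      if s' ∈ T (k + 1) then
        ∑ s, ∑ a, truncVisit P1 P T π k (some s) * π k s a * P k s a s'
      else 0
  | k + 1, none =>
      truncVisit P1 P T π k none +
        ∑ s, ∑ a, truncVisit P1 P T π k (some s) * π k s a *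
          ∑ s' ∈ Finset.univ.filter (fun s' => s' ∉ T (k + 1)), P k s a s'

/-- Supremum over all valid policies. -/
noncomputable def polSup [Fintype A] (f : (ℕ → S → A → ℝ) → ℝ) : ℝ :=
  sSup (f '' {π | IsPolicy π})

/-- `prefixSets P1 P σ k` is the family of truncation sets of the truncated MDP
`M̄_{k+1}(∅)` of the informal statement: it equals `S_{j+1}(∅)` for `j ≤ k` and the
whole state space for `j > k`. -/
noncomputable def prefixSets [Fintype S] [Fintype A] (P1 : S → ℝ)
    (P : ℕ → S → A → S → ℝ) (σ : ℝ) : ℕ → ℕ → Set S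
  | 0 => fun j => if j = 0 then {s | σ ≤ P1 s} else Set.univ
  | k + 1 => fun j =>
      if j ≤ k then prefixSets P1 P σ k j
      else if j = k + 1 then
        {s | σ ≤ polSup fun π =>
          truncVisit P1 P (prefixSets P1 P σ k) π (k + 1) (some s)}
      else Set.univ

/-- `SRchEmpty P1 P σ k` is the set `S_{k+1}(∅)` of the informal statement; the family
`SRchEmpty P1 P σ` is the family of truncation sets of `M̄(∅)`. -/
noncomputable def SRchEmpty [Fintype S] [Fintype A] (P1 : S → ℝ)
    (P : ℕ → S → A → S → ℝ) (σ : ℝ) (k : ℕ) : Set S :=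
  prefixSets P1 P σ k k

/-- `SRchGam P1 P σ σ' Γ k` is the set `S_{k+1}(Γ)` of the informal statement (for
`Γ = ∅` it coincides with `SRchEmpty`, since then the second set below is empty);
the family `SRchGam P1 P σ σ' Γ` is the family of truncation sets of `M̄(Γ)`. -/
noncomputable def SRchGam [Fintype S] [Fintype A] (P1 : S → ℝ)
    (P : ℕ → S → A → S → ℝ) (σ σ' : ℝ) (Γ : Finset (ℕ → S → A → ℝ)) (k : ℕ) :
    Set S :=
  SRchEmpty P1 P σ k ∪
    {s | σ' ≤ (Γ.card : ℝ)⁻¹ * ∑ π ∈ Γ, visit P1 P π k s}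

end MDPDefs

section Visitation

variable {S A : Type*} [Fintype A] {P1 : S → ℝ} {P : ℕ → S → A → S → ℝ}
  {π : ℕ → S → A → ℝ}

lemma IsPolicy.le_one (hπ : IsPolicy π) (k : ℕ) (s : S) (a : A) : π k s a ≤ 1 :=
  (hπ k s).2 ▸ Finset.single_le_sum (fun b _ => (hπ k s).1 b) (Finset.mem_univ a)

lemma mul_polSup_le (hne : ∃ π : ℕ → S → A → ℝ, IsPolicy π) {m c : ℝ} (hm : 0 < m)
    {f : (ℕ → S → A → ℝ) → ℝ} (hf : ∀ π, IsPolicy π → m * f π ≤ c) :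
    m * polSup f ≤ c := by
  rw [← le_div_iff₀' hm]
  refine csSup_le (Set.Nonempty.image f hne) ?_
  rintro _ ⟨π, hπ, rfl⟩
  exact (le_div_iff₀' hm).2 (hf π hπ)

variable [Fintype S]

lemma visit_nonneg (hP1 : ∀ s, 0 ≤ P1 s) (hP : ∀ k s a s', 0 ≤ P k s a s')
    (hπ : IsPolicy π) (k : ℕ) (s : S) : 0 ≤ visit P1 P π k s := by
  induction k generalizing s with
  | zero => exact hP1 s
  | succ k ih =>
    exact Finset.sum_nonneg fun t _ => Finset.sum_nonneg fun a _ =>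
      mul_nonneg (mul_nonneg (ih t) ((hπ k t).1 a)) (hP k t a s)

lemma sum_visit (hP1 : ∑ s, P1 s = 1) (hP : ∀ k s a, ∑ s', P k s a s' = 1)
    (hπ : IsPolicy π) (k : ℕ) : ∑ s, visit P1 P π k s = 1 := by
  induction k with
  | zero => exact hP1
  | succ k ih =>
    simp only [visit]
    rw [Finset.sum_comm]
    refine Eq.trans (Finset.sum_congr rfl fun s _ => ?_) ih
    rw [Finset.sum_comm]
    simp_rw [← Finset.mul_sum, hP, mul_one, ← Finset.mul_sum, (hπ k s).2, mul_one]

lemma visit_le_one (hP1 : (∀ s, 0 ≤ P1 s) ∧ ∑ s, P1 s = 1)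
    (hP : ∀ k s a, (∀ s', 0 ≤ P k s a s') ∧ ∑ s', P k s a s' = 1)
    (hπ : IsPolicy π) (k : ℕ) (s : S) : visit P1 P π k s ≤ 1 := by
  rw [← sum_visit hP1.2 (fun k s a => (hP k s a).2) hπ k]
  exact Finset.single_le_sum
    (fun t _ => visit_nonneg hP1.1 (fun k s a => (hP k s a).1) hπ k t) (Finset.mem_univ s)

lemma avg_visit_nonneg (hP1 : ∀ s, 0 ≤ P1 s) (hP : ∀ k s a s', 0 ≤ P k s a s')
    {Ψ : Finset (ℕ → S → A → ℝ)} (hΨ : ∀ π ∈ Ψ, IsPolicy π) (k : ℕ) (s : S) :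
    0 ≤ (Ψ.card : ℝ)⁻¹ * ∑ π ∈ Ψ, visit P1 P π k s :=
  mul_nonneg (by positivity)
    (Finset.sum_nonneg fun π hπ => visit_nonneg hP1 hP (hΨ π hπ) k s)

lemma truncVisit_nonneg (hP1 : ∀ s, 0 ≤ P1 s) (hP : ∀ k s a s', 0 ≤ P k s a s')
    (hπ : IsPolicy π) (T : ℕ → Set S) (k : ℕ) (s : S) :
    0 ≤ truncVisit P1 P T π k (some s) := by
  induction k generalizing s with
  | zero =>
    simp only [truncVisit]
    split_ifs
    exacts [hP1 s, le_rfl]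
  | succ k ih =>
    simp only [truncVisit]
    split_ifs
    · exact Finset.sum_nonneg fun t _ => Finset.sum_nonneg fun a _ =>
        mul_nonneg (mul_nonneg (ih t) ((hπ k t).1 a)) (hP k t a s)
    · exact le_rfl

lemma truncVisit_le_visit (hP1 : ∀ s, 0 ≤ P1 s) (hP : ∀ k s a s', 0 ≤ P k s a s')
    (hπ : IsPolicy π) (T : ℕ → Set S) (k : ℕ) (s : S) :
    truncVisit P1 P T π k (some s) ≤ visit P1 P π k s := by
  induction k generalizing s with
  | zero =>
    simp only [truncVisit, visit]
    split_ifs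
    exacts [le_rfl, hP1 s]
  | succ k ih =>
    have hv := visit_nonneg hP1 hP hπ (k + 1) s
    simp only [truncVisit]
    split_ifs
    · exact Finset.sum_le_sum fun t _ => Finset.sum_le_sum fun a _ =>
        mul_le_mul_of_nonneg_right
          (mul_le_mul_of_nonneg_right (ih t) ((hπ k t).1 a)) (hP k t a s)
    · exact hv

lemma truncVisit_of_notMem {T : ℕ → Set S} {k : ℕ} {s : S} (hs : s ∉ T k) :
    truncVisit P1 P T π k (some s) = 0 := by
  cases k <;> simp [truncVisit, hs]

lemma truncVisit_succ_le (hP1 : ∀ s, 0 ≤ P1 s) (hP : ∀ k s a s', 0 ≤ P k s a s')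
    (hπ : IsPolicy π) (T : ℕ → Set S) (k : ℕ) (s' : S) :
    truncVisit P1 P T π (k + 1) (some s') ≤
      ∑ s, truncVisit P1 P T π k (some s) * ∑ a, P k s a s' := by
  have hT := fun s => truncVisit_nonneg hP1 hP hπ T k s
  rw [truncVisit]
  split_ifs
  · refine Finset.sum_le_sum fun s _ => ?_
    rw [Finset.mul_sum]
    exact Finset.sum_le_sum fun a _ => mul_le_mul_of_nonneg_right
      (mul_le_of_le_one_right (hT s) (hπ.le_one k s a)) (hP k s a s')
  · exact Finset.sum_nonneg fun s _ =>
      mul_nonneg (hT s) (Finset.sum_nonneg fun a _ => hP k s a s')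

lemma truncVisit_congr {T T' : ℕ → Set S} {k : ℕ} (hT : ∀ j ≤ k, T j = T' j) (s : S) :
    truncVisit P1 P T π k (some s) = truncVisit P1 P T' π k (some s) := by
  induction k generalizing s with
  | zero => simp only [truncVisit, hT 0 le_rfl]
  | succ k ih =>
    simp only [truncVisit, hT (k + 1) le_rfl, ih fun j hj => hT j (by omega)]

lemma truncVisit_succ_congr_of_mem {T T' : ℕ → Set S} {k : ℕ} (hT : ∀ j ≤ k, T j = T' j)
    {s : S} (hs : s ∈ T (k + 1)) (hs' : s ∈ T' (k + 1)) :
    truncVisit P1 P T π (k + 1) (some s) = truncVisit P1 P T' π (k + 1) (some s) := by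
  simp only [truncVisit, hs, hs', if_true, truncVisit_congr hT]

lemma prefixSets_eq_SRchEmpty (σ : ℝ) {j k : ℕ} (hjk : j ≤ k) :
    prefixSets P1 P σ k j = SRchEmpty P1 P σ j := by
  induction k with
  | zero =>
    obtain rfl : j = 0 := by omega
    rfl
  | succ k ih =>
    rcases hjk.lt_or_eq with hlt | rfl
    · have hle : j ≤ k := by omega
      simp only [prefixSets, if_pos hle, ih hle]
    · rfl

lemma prefixSets_of_lt (σ : ℝ) {j k : ℕ} (hkj : k < j) :
    prefixSets P1 P σ k j = Set.univ := by
  cases k with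
  | zero => simp [prefixSets, hkj.ne']
  | succ k =>
    have h1 : ¬ j ≤ k := by omega
    simp [prefixSets, h1, hkj.ne']

lemma le_polSup_truncVisit_of_mem_SRchEmpty (hne : ∃ π : ℕ → S → A → ℝ, IsPolicy π) {σ : ℝ}
    {k : ℕ} {s : S} (hs : s ∈ SRchEmpty P1 P σ k) :
    σ ≤ polSup fun π => truncVisit P1 P (SRchEmpty P1 P σ) π k (some s) := by
  cases k with
  | zero =>
    have hne' : {π : ℕ → S → A → ℝ | IsPolicy π}.Nonempty := hne
    have hσ : σ ≤ P1 s := by simpa [SRchEmpty, prefixSets] using hs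
    simpa only [polSup, truncVisit, hs, if_true, hne'.image_const, csSup_singleton] using hσ
  | succ k =>
    have hσ : σ ≤ polSup fun π =>
        truncVisit P1 P (prefixSets P1 P σ k) π (k + 1) (some s) := by
      simpa [SRchEmpty, prefixSets] using hs
    refine hσ.trans_eq (congrArg polSup (funext fun π => ?_))
    exact truncVisit_succ_congr_of_mem (fun j hj => prefixSets_eq_SRchEmpty σ hj)
      (by simp [prefixSets_of_lt σ (Nat.lt_succ_self k)]) hs

end Visitation

/-- Fix `h ∈ {1,…,H−1}` and `α > 0`, let `Ψ, Γ` be finite nonempty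
sets of policies with `Ψ` an `α`-truncated policy cover at step `h`, and let `ρ` be
the mixture `½·Unif(Ψ) + ½·Unif(Γ)`.  Then:
(1) for every `s ∈ S_h(Γ)`: `E_{π∼ρ}[d^{M,π}_h(s)] ≥ min(ασ,σ′)/2`;
(2) for every `f : S ∪ {⊥} → [0,∞)` with `f ⊥ = 0`:
    `E_{π∼ρ}[E^{M,π}[f(s_h)]] ≥ (min(ασ,σ′)/2)·sup_{π∈Π} E^{M̄(Γ),π}[f(s_h)]`;
(3) for every `s′ ∈ S`:
    `Σ_s E_{π∼ρ}[d^{M,π}_h(s)]·(1/|A|)Σ_a P_{h+1}(s′|s,a)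
       ≥ (min(ασ,σ′)/(2|A|))·sup_{π∈Π} d^{M̄(Γ),π}_{h+1}(s′)`.
(Informal step `h` is internal index `h - 1`; the transition kernel `P_{h+1}` of the
informal statement is `P (h-1)`.) -/
theorem stmt12 {S A : Type*} [Fintype S] [Fintype A] [Nonempty S] [Nonempty A]
    (P1 : S → ℝ) (hP1 : (∀ s, 0 ≤ P1 s) ∧ ∑ s, P1 s = 1)
    (P : ℕ → S → A → S → ℝ)
    (hP : ∀ k s a, (∀ s', 0 ≤ P k s a s') ∧ ∑ s', P k s a s' = 1)
    (H : ℕ) (hH : 1 ≤ H) (σ σ' α : ℝ) (hσ' : 0 < σ') (hσ : σ' ≤ σ) (hα : 0 < α)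
    (Ψ Γ : Finset (ℕ → S → A → ℝ)) (hΨne : Ψ.Nonempty) (hΓne : Γ.Nonempty)
    (hΨpol : ∀ π ∈ Ψ, IsPolicy π) (hΓpol : ∀ π ∈ Γ, IsPolicy π)
    (h : ℕ) (hh1 : 1 ≤ h) (hh2 : h ≤ H - 1)
    (hcover : ∀ s : S,
      α * polSup (fun π => truncVisit P1 P (SRchEmpty P1 P σ) π (h - 1) (some s)) ≤
        (Ψ.card : ℝ)⁻¹ * ∑ π ∈ Ψ, visit P1 P π (h - 1) s) :
    (∀ s ∈ SRchGam P1 P σ σ' Γ (h - 1),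
      min (α * σ) σ' / 2 ≤
        (1 / 2) * ((Ψ.card : ℝ)⁻¹ * ∑ π ∈ Ψ, visit P1 P π (h - 1) s) +
          (1 / 2) * ((Γ.card : ℝ)⁻¹ * ∑ π ∈ Γ, visit P1 P π (h - 1) s)) ∧
    (∀ f : Option S → ℝ, (∀ x, 0 ≤ f x) → f none = 0 →
      (min (α * σ) σ' / 2) *
          polSup (fun π => ∑ x,
            truncVisit P1 P (SRchGam P1 P σ σ' Γ) π (h - 1) x * f x) ≤
        (1 / 2) * ((Ψ.card : ℝ)⁻¹ *
            ∑ π ∈ Ψ, ∑ s, visit P1 P π (h - 1) s * f (some s)) +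
          (1 / 2) * ((Γ.card : ℝ)⁻¹ *
            ∑ π ∈ Γ, ∑ s, visit P1 P π (h - 1) s * f (some s))) ∧
    (∀ s' : S,
      (min (α * σ) σ' / (2 * Fintype.card A)) *
          polSup (fun π => truncVisit P1 P (SRchGam P1 P σ σ' Γ) π h (some s')) ≤
        ∑ s, ((1 / 2) * ((Ψ.card : ℝ)⁻¹ * ∑ π ∈ Ψ, visit P1 P π (h - 1) s) +
              (1 / 2) * ((Γ.card : ℝ)⁻¹ * ∑ π ∈ Γ, visit P1 P π (h - 1) s)) *
          ((Fintype.card A : ℝ)⁻¹ * ∑ a, P (h - 1) s a s')) := by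
  have hP1' := hP1.1
  have hP' := fun k s a => (hP k s a).1
  have hne : ∃ π : ℕ → S → A → ℝ, IsPolicy π := hΨne.imp hΨpol
  have hm : 0 < min (α * σ) σ' := lt_min (mul_pos hα (hσ'.trans_le hσ)) hσ'
  obtain ⟨k, rfl⟩ : ∃ k, h = k + 1 := ⟨h - 1, by omega⟩
  simp only [Nat.add_sub_cancel] at hcover ⊢
  set μ : S → ℝ := fun s => (1 / 2) * ((Ψ.card : ℝ)⁻¹ * ∑ π ∈ Ψ, visit P1 P π k s) +
    (1 / 2) * ((Γ.card : ℝ)⁻¹ * ∑ π ∈ Γ, visit P1 P π k s) with hμ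
  have hΨ0 := fun s => avg_visit_nonneg hP1' hP' hΨpol k s
  have hΓ0 := fun s => avg_visit_nonneg hP1' hP' hΓpol k s
  have hμ0 : ∀ s, 0 ≤ μ s := fun s => by
    have h1 := hΨ0 s
    have h2 := hΓ0 s
    simp only [hμ]
    linarith
  have hreach : ∀ s ∈ SRchGam P1 P σ σ' Γ k, min (α * σ) σ' / 2 ≤ μ s := by
    intro s hs
    have h1 := hΨ0 s
    have h2 := hΓ0 s
    simp only [hμ]
    rcases hs with hs | hs
    · have h3 := mul_le_mul_of_nonneg_left
        (le_polSup_truncVisit_of_mem_SRchEmpty hne hs) hα.le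
      have h4 := hcover s
      have h5 := min_le_left (α * σ) σ'
      linarith
    · have h3 : σ' ≤ (Γ.card : ℝ)⁻¹ * ∑ π ∈ Γ, visit P1 P π k s := hs
      have h5 := min_le_right (α * σ) σ'
      linarith
  have hdom : ∀ π, IsPolicy π → ∀ s, min (α * σ) σ' / 2 *
      truncVisit P1 P (SRchGam P1 P σ σ' Γ) π k (some s) ≤ μ s := by
    intro π hπ s
    by_cases hs : s ∈ SRchGam P1 P σ σ' Γ k
    · refine (mul_le_of_le_one_right (by positivity) ?_).trans (hreach s hs)
      exact (truncVisit_le_visit hP1' hP' hπ _ k s).trans (visit_le_one hP1 hP hπ k s)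
    · rw [truncVisit_of_notMem hs, mul_zero]
      exact hμ0 s
  refine ⟨hreach, fun f hf hf0 => mul_polSup_le hne (by positivity) fun π hπ => ?_,
    fun s' => mul_polSup_le hne (by positivity) fun π hπ => ?_⟩
  · have hswap : ∀ Θ : Finset (ℕ → S → A → ℝ),
        ∑ π ∈ Θ, ∑ s, visit P1 P π k s * f (some s) =
          ∑ s, (∑ π ∈ Θ, visit P1 P π k s) * f (some s) := fun Θ => by
      rw [Finset.sum_comm]
      simp only [Finset.sum_mul]
    calc min (α * σ) σ' / 2 *
          ∑ x, truncVisit P1 P (SRchGam P1 P σ σ' Γ) π k x * f x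
        = ∑ s, min (α * σ) σ' / 2 *
            truncVisit P1 P (SRchGam P1 P σ σ' Γ) π k (some s) * f (some s) := by
          rw [Fintype.sum_option, hf0, mul_zero, zero_add, Finset.mul_sum]
          simp only [mul_assoc]
      _ ≤ ∑ s, μ s * f (some s) := Finset.sum_le_sum fun s _ =>
          mul_le_mul_of_nonneg_right (hdom π hπ s) (hf _)
      _ = _ := by
          rw [hswap, hswap]
          simp only [hμ, add_mul, mul_assoc, Finset.sum_add_distrib, ← Finset.mul_sum]
  · have hA : (0 : ℝ) < Fintype.card A := by exact_mod_cast Fintype.card_pos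
    calc min (α * σ) σ' / (2 * Fintype.card A) *
          truncVisit P1 P (SRchGam P1 P σ σ' Γ) π (k + 1) (some s')
        ≤ min (α * σ) σ' / (2 * Fintype.card A) *
            ∑ s, truncVisit P1 P (SRchGam P1 P σ σ' Γ) π k (some s) * ∑ a, P k s a s' :=
          mul_le_mul_of_nonneg_left (truncVisit_succ_le hP1' hP' hπ _ k s') (by positivity)
      _ = ∑ s, min (α * σ) σ' / 2 *
            truncVisit P1 P (SRchGam P1 P σ σ' Γ) π k (some s) *
              ((Fintype.card A : ℝ)⁻¹ * ∑ a, P k s a s') := by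
          rw [Finset.mul_sum]
          refine Finset.sum_congr rfl fun s _ => ?_
          field_simp
      _ ≤ _ := Finset.sum_le_sum fun s _ => mul_le_mul_of_nonneg_right (hdom π hπ s)
          (mul_nonneg (by positivity) (Finset.sum_nonneg fun a _ => hP' k s a s'))
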